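/- For every α > 0 there is a constant C_α such that for all 0 < y < 1/2 the function x ↦ 𝐈(x+iy)^{α} is integrable on [−1,1] and: ∫_{−1}^{1} 𝐈(x+iy)^{α} dx ≤ C_α if 0 < α < 1; ∫_{−1}^{1} 𝐈(x+iy) dx ≤ C₁ log(1/y) if α = 1; and ∫_{−1}^{1} 𝐈(x+iy)^{α} dx ≤ C_α y^{1−α} if α > 1. -/

import Mathlib

open Complex MeasureTheory Filter Topology

/-- `𝐈(x+iy) = sup { y/((cx-d)² + c²y²) : (c,d) coprime, cd even }`. -/
noncomputable def bI (x y : ℝ) : ℝ :=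
  sSup {r : ℝ | ∃ c d : ℤ, Int.gcd c d = 1 ∧ Even (c * d) ∧
    r = y / (((c : ℝ) * x - (d : ℝ)) ^ 2 + (c : ℝ) ^ 2 * y ^ 2)}

theorem bI_term_le {x y : ℝ} (hy : 0 < y) (hy1 : y < 1 / 2) (c d : ℤ) :
    y / (((c : ℝ) * x - (d : ℝ)) ^ 2 + (c : ℝ) ^ 2 * y ^ 2) ≤ 1 / y := by
  have hyy : y ≤ 1 / y := by rw [le_div_iff₀ hy]; nlinarith
  rcases eq_or_ne c 0 with rfl | hc
  · rcases eq_or_ne d 0 with rfl | hd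
    · simp [hy.le]
    · have h1 : (1 : ℝ) ≤ (d : ℝ) ^ 2 := by
        exact_mod_cast Int.one_le_abs (pow_ne_zero 2 hd) |>.trans_eq (abs_of_nonneg (sq_nonneg d))
      refine le_trans ?_ hyy
      simpa using div_le_self hy.le h1
  · have h1 : (1 : ℝ) ≤ (c : ℝ) ^ 2 := by
      exact_mod_cast Int.one_le_abs (pow_ne_zero 2 hc) |>.trans_eq (abs_of_nonneg (sq_nonneg c))
    have hy2 : 0 < y ^ 2 := by positivity
    rw [div_le_div_iff₀ (by positivity) hy]
    nlinarith [sq_nonneg ((c : ℝ) * x - d)]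

theorem bI_set_nonempty (x y : ℝ) :
    {r : ℝ | ∃ c d : ℤ, Int.gcd c d = 1 ∧ Even (c * d) ∧
      r = y / (((c : ℝ) * x - (d : ℝ)) ^ 2 + (c : ℝ) ^ 2 * y ^ 2)}.Nonempty :=
  ⟨_, 0, 1, by simp, by simp, rfl⟩

theorem bI_nonneg {x y : ℝ} (hy : 0 < y) : 0 ≤ bI x y := by
  apply Real.sSup_nonneg
  rintro r ⟨c, d, -, -, rfl⟩
  positivity

theorem bI_le_one_div {x y : ℝ} (hy : 0 < y) (hy1 : y < 1 / 2) : bI x y ≤ 1 / y := by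
  apply csSup_le (bI_set_nonempty x y)
  rintro r ⟨c, d, -, -, rfl⟩
  exact bI_term_le hy hy1 c d

theorem measurable_bI (y : ℝ) : Measurable fun x => bI x y := by
  have h : (fun x => bI x y) = fun x =>
      ⨆ p : {p : ℤ × ℤ // Int.gcd p.1 p.2 = 1 ∧ Even (p.1 * p.2)},
        y / (((p.1.1 : ℝ) * x - (p.1.2 : ℝ)) ^ 2 + (p.1.1 : ℝ) ^ 2 * y ^ 2) := by
    funext x
    unfold bI iSup
    congr 1
    ext r
    constructor
    · rintro ⟨c, d, h1, h2, rfl⟩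
      exact ⟨⟨(c, d), h1, h2⟩, rfl⟩
    · rintro ⟨⟨⟨c, d⟩, h1, h2⟩, rfl⟩
      exact ⟨c, d, h1, h2, rfl⟩
  rw [h]
  exact Measurable.iSup fun p => by fun_prop

theorem integrableOn_bI_rpow {α y : ℝ} (hα : 0 < α) (hy : 0 < y) (hy1 : y < 1 / 2) :
    IntegrableOn (fun x : ℝ => bI x y ^ α) (Set.Icc (-1 : ℝ) 1) := by
  refine Measure.integrableOn_of_bounded (M := (1 / y) ^ α) (by simp)
    ((measurable_bI y).pow_const α).aestronglyMeasurable (ae_of_all _ fun x => ?_)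
  rw [Real.norm_of_nonneg (Real.rpow_nonneg (bI_nonneg hy) _)]
  exact Real.rpow_le_rpow (bI_nonneg hy) (bI_le_one_div hy hy1) hα.le

theorem exists_index_of_one_lt_bI_term {x y : ℝ} (hx : x ∈ Set.Icc (-1 : ℝ) 1) (hy : 0 < y)
    (hy1 : y < 1 / 2) (c d : ℤ)
    (h : 1 < y / (((c : ℝ) * x - (d : ℝ)) ^ 2 + (c : ℝ) ^ 2 * y ^ 2)) :
    ∃ n ∈ Finset.Icc 1 ⌊1 / √y⌋₊, ∃ m ∈ Finset.Icc (-(n : ℤ)) n,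
      y / (((c : ℝ) * x - (d : ℝ)) ^ 2 + (c : ℝ) ^ 2 * y ^ 2) =
      y / (((n : ℝ) * x - (m : ℝ)) ^ 2 + (n : ℝ) ^ 2 * y ^ 2) := by
  have hc : c ≠ 0 := by
    rintro rfl
    rcases eq_or_ne d 0 with rfl | hd
    · norm_num at h
    · have h1 : (1 : ℝ) ≤ (d : ℝ) ^ 2 := by
        exact_mod_cast Int.one_le_abs (pow_ne_zero 2 hd) |>.trans_eq (abs_of_nonneg (sq_nonneg d))
      have := div_le_self hy.le h1
      simp at h
      linarith
  have key : ∀ (n : ℕ) (m : ℤ), n ≠ 0 →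
      1 < y / (((n : ℝ) * x - (m : ℝ)) ^ 2 + (n : ℝ) ^ 2 * y ^ 2) →
      n ∈ Finset.Icc 1 ⌊1 / √y⌋₊ ∧ m ∈ Finset.Icc (-(n : ℤ)) n := by
    intro n m hn h
    have hn' : (0 : ℝ) < n := by exact_mod_cast Nat.pos_of_ne_zero hn
    rw [one_lt_div (by positivity)] at h
    have h1 : (n : ℝ) ^ 2 * y < 1 := by
      have : ((n : ℝ) ^ 2 * y) * y < 1 * y := by nlinarith [sq_nonneg ((n : ℝ) * x - m)]
      exact lt_of_mul_lt_mul_right this hy.le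
    have h2 : ((n : ℝ) * x - m) ^ 2 < 1 := by
      have : 0 < (n : ℝ) ^ 2 * y ^ 2 := by positivity
      linarith
    rw [sq_lt_one_iff_abs_lt_one, abs_lt] at h2
    refine ⟨Finset.mem_Icc.2 ⟨Nat.pos_of_ne_zero hn, Nat.le_floor ?_⟩, Finset.mem_Icc.2 ?_⟩
    · rw [le_div_iff₀ (Real.sqrt_pos.2 hy)]
      refine (sq_le_one_iff₀ (by positivity)).1 ?_
      rw [mul_pow, Real.sq_sqrt hy.le]
      exact h1.le
    · have h3 : (m : ℝ) < n + 1 := by nlinarith [hx.2]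
      have h4 : -(n : ℝ) - 1 < m := by nlinarith [hx.1]
      have h3' : m < n + 1 := by exact_mod_cast h3
      have h4' : -(n : ℤ) - 1 < m := by exact_mod_cast h4
      omega
  obtain ⟨n, rfl | rfl⟩ := c.eq_nat_or_neg
  · have hn : n ≠ 0 := by simpa using hc
    have h' := key n d hn (by simpa using h)
    exact ⟨n, h'.1, d, h'.2, by simp⟩
  · have hn : n ≠ 0 := by simpa using hc
    have e : y / ((((-(n : ℤ) : ℤ) : ℝ) * x - (d : ℝ)) ^ 2 + ((-(n : ℤ) : ℤ) : ℝ) ^ 2 * y ^ 2) =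
        y / (((n : ℝ) * x - ((-d : ℤ) : ℝ)) ^ 2 + (n : ℝ) ^ 2 * y ^ 2) := by
      push_cast
      congr 1
      ring
    have h' := key n (-d) hn (by rwa [e] at h)
    exact ⟨n, h'.1, -d, h'.2, e⟩

theorem bI_rpow_le_one_add_sum {β x y : ℝ} (hβ : 0 < β) (hx : x ∈ Set.Icc (-1 : ℝ) 1) (hy : 0 < y)
    (hy1 : y < 1 / 2) :
    bI x y ^ β ≤ 1 + ∑ n ∈ Finset.Icc 1 ⌊1 / √y⌋₊, ∑ m ∈ Finset.Icc (-(n : ℤ)) n,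
      (y / (((n : ℝ) * x - (m : ℝ)) ^ 2 + (n : ℝ) ^ 2 * y ^ 2)) ^ β := by
  set S := ∑ n ∈ Finset.Icc 1 ⌊1 / √y⌋₊, ∑ m ∈ Finset.Icc (-(n : ℤ)) n,
      (y / (((n : ℝ) * x - (m : ℝ)) ^ 2 + (n : ℝ) ^ 2 * y ^ 2)) ^ β with hS
  have hS0 : 0 ≤ S := Finset.sum_nonneg fun n _ => Finset.sum_nonneg fun m _ => by positivity
  rw [← Real.le_rpow_inv_iff_of_pos (bI_nonneg hy) (by positivity) hβ]
  apply csSup_le (bI_set_nonempty x y)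
  rintro r ⟨c, d, -, -, rfl⟩
  rw [Real.le_rpow_inv_iff_of_pos (by positivity) (by positivity) hβ]
  rcases le_or_gt (y / (((c : ℝ) * x - (d : ℝ)) ^ 2 + (c : ℝ) ^ 2 * y ^ 2)) 1 with h | h
  · linarith [Real.rpow_le_one (by positivity) h hβ.le]
  · obtain ⟨n, hn, m, hm, e⟩ := exists_index_of_one_lt_bI_term hx hy hy1 c d h
    rw [e]
    have h1 := Finset.single_le_sum (s := Finset.Icc (-(n : ℤ)) n)
      (f := fun m : ℤ => (y / (((n : ℝ) * x - (m : ℝ)) ^ 2 + (n : ℝ) ^ 2 * y ^ 2)) ^ β)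
      (fun m _ => by positivity) hm
    have h2 := Finset.single_le_sum (s := Finset.Icc 1 ⌊1 / √y⌋₊)
      (f := fun n : ℕ => ∑ m ∈ Finset.Icc (-(n : ℤ)) n,
        (y / (((n : ℝ) * x - (m : ℝ)) ^ 2 + (n : ℝ) ^ 2 * y ^ 2)) ^ β)
      (fun n _ => Finset.sum_nonneg fun m _ => by positivity) hn
    linarith

theorem integrable_one_add_sq_rpow_neg {β : ℝ} (hβ : 1 / 2 < β) :
    Integrable fun t : ℝ => (1 + t ^ 2) ^ (-β) := by
  have h := integrable_rpow_neg_one_add_norm_sq (E := ℝ) (μ := volume) (r := 2 * β)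
    (by simp; linarith)
  refine h.congr (ae_of_all _ fun t => ?_)
  simp only [Real.norm_eq_abs, sq_abs]
  congr 1
  ring

theorem bI_term_rpow_eq (β x : ℝ) {y : ℝ} (hy : 0 < y) {n : ℕ} (hn : n ≠ 0) (m : ℤ) :
    (y / (((n : ℝ) * x - (m : ℝ)) ^ 2 + (n : ℝ) ^ 2 * y ^ 2)) ^ β =
      ((n : ℝ) ^ 2 * y) ^ (-β) * (1 + ((x - m / n) / y) ^ 2) ^ (-β) := by
  have hn' : (0 : ℝ) < n := by exact_mod_cast Nat.pos_of_ne_zero hn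
  rw [← Real.mul_rpow (by positivity) (by positivity), Real.rpow_neg (by positivity),
    ← Real.inv_rpow (by positivity)]
  congr 1
  field_simp
  ring

theorem integrable_bI_term_rpow {β y : ℝ} (hβ : 1 / 2 < β) (hy : 0 < y) {n : ℕ} (hn : n ≠ 0)
    (m : ℤ) :
    Integrable fun x : ℝ => (y / (((n : ℝ) * x - (m : ℝ)) ^ 2 + (n : ℝ) ^ 2 * y ^ 2)) ^ β := by
  simp_rw [fun x => bI_term_rpow_eq β x hy hn m]
  exact (((integrable_one_add_sq_rpow_neg hβ).comp_div hy.ne').comp_sub_right _).const_mul _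

theorem integral_bI_term_rpow (β : ℝ) {y : ℝ} (hy : 0 < y) {n : ℕ} (hn : n ≠ 0) (m : ℤ) :
    ∫ x : ℝ, (y / (((n : ℝ) * x - (m : ℝ)) ^ 2 + (n : ℝ) ^ 2 * y ^ 2)) ^ β =
      (n : ℝ) ^ (-2 * β) * y ^ (1 - β) * ∫ t : ℝ, (1 + t ^ 2) ^ (-β) := by
  simp_rw [fun x => bI_term_rpow_eq β x hy hn m]
  rw [integral_const_mul,
    integral_sub_right_eq_self (fun x : ℝ => (1 + (x / y) ^ 2) ^ (-β)) ((m : ℝ) / n),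
    Measure.integral_comp_div (fun t : ℝ => (1 + t ^ 2) ^ (-β)) y, abs_of_pos hy, smul_eq_mul,
    Real.mul_rpow (by positivity) hy.le, ← Real.rpow_natCast_mul (by positivity),
    sub_eq_neg_add, Real.rpow_add hy, Real.rpow_one]
  push_cast
  rw [show (2 : ℝ) * -β = -2 * β by ring]
  ring

theorem integral_bI_rpow_le {β y : ℝ} (hβ : 1 / 2 < β) (hy : 0 < y) (hy1 : y < 1 / 2) :
    ∫ x in Set.Icc (-1 : ℝ) 1, bI x y ^ β ≤
      2 + 3 * (∫ t : ℝ, (1 + t ^ 2) ^ (-β)) *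
        ((∑ n ∈ Finset.Icc 1 ⌊1 / √y⌋₊, (n : ℝ) ^ (1 - 2 * β)) * y ^ (1 - β)) := by
  set K := ∫ t : ℝ, (1 + t ^ 2) ^ (-β)
  have hK : 0 ≤ K := integral_nonneg fun t => by positivity
  have hne : ∀ n ∈ Finset.Icc 1 ⌊1 / √y⌋₊, n ≠ 0 := fun n hn =>
    Nat.one_le_iff_ne_zero.1 (Finset.mem_Icc.1 hn).1
  have hint : ∀ n ∈ Finset.Icc 1 ⌊1 / √y⌋₊, ∀ m ∈ Finset.Icc (-(n : ℤ)) n,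
      IntegrableOn (fun x : ℝ => (y / (((n : ℝ) * x - (m : ℝ)) ^ 2 + (n : ℝ) ^ 2 * y ^ 2)) ^ β)
        (Set.Icc (-1 : ℝ) 1) := fun n hn m _ =>
    (integrable_bI_term_rpow hβ hy (hne n hn) m).integrableOn
  have hint' := fun n hn => integrable_finsetSum _ (hint n hn)
  calc ∫ x in Set.Icc (-1 : ℝ) 1, bI x y ^ β
      ≤ ∫ x in Set.Icc (-1 : ℝ) 1,
        (1 + ∑ n ∈ Finset.Icc 1 ⌊1 / √y⌋₊, ∑ m ∈ Finset.Icc (-(n : ℤ)) n,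
          (y / (((n : ℝ) * x - (m : ℝ)) ^ 2 + (n : ℝ) ^ 2 * y ^ 2)) ^ β) := by
        refine setIntegral_mono_on (integrableOn_bI_rpow (by linarith) hy hy1) ?_
          measurableSet_Icc fun x hx => bI_rpow_le_one_add_sum (by linarith) hx hy hy1
        exact (integrable_const _).add (integrable_finsetSum _ hint')
    _ = 2 + ∑ n ∈ Finset.Icc 1 ⌊1 / √y⌋₊, ∑ m ∈ Finset.Icc (-(n : ℤ)) n,
          ∫ x in Set.Icc (-1 : ℝ) 1,
            (y / (((n : ℝ) * x - (m : ℝ)) ^ 2 + (n : ℝ) ^ 2 * y ^ 2)) ^ β := by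
        rw [integral_add (integrable_const _) (integrable_finsetSum _ hint'),
          integral_finsetSum _ hint']
        congr 1
        · norm_num
        · exact Finset.sum_congr rfl fun n hn => integral_finsetSum _ (hint n hn)
    _ ≤ 2 + ∑ n ∈ Finset.Icc 1 ⌊1 / √y⌋₊, 3 * K * ((n : ℝ) ^ (1 - 2 * β) * y ^ (1 - β)) := by
        gcongr with n hn
        have hn0 := hne n hn
        have hn1 : (1 : ℝ) ≤ n := by exact_mod_cast Nat.pos_of_ne_zero hn0
        calc ∑ m ∈ Finset.Icc (-(n : ℤ)) n, ∫ x in Set.Icc (-1 : ℝ) 1,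
              (y / (((n : ℝ) * x - (m : ℝ)) ^ 2 + (n : ℝ) ^ 2 * y ^ 2)) ^ β
            ≤ ∑ m ∈ Finset.Icc (-(n : ℤ)) n, (n : ℝ) ^ (-2 * β) * y ^ (1 - β) * K := by
              refine Finset.sum_le_sum fun m _ => ?_
              rw [← integral_bI_term_rpow β hy hn0 m]
              exact setIntegral_le_integral (integrable_bI_term_rpow hβ hy hn0 m)
                (ae_of_all _ fun x => by simp only [Pi.zero_apply]; positivity)
          _ = (2 * n + 1) * ((n : ℝ) ^ (-2 * β) * y ^ (1 - β) * K) := by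
              have hcard : (n + 1 - -(n : ℤ)).toNat = 2 * n + 1 := by omega
              rw [Finset.sum_const, Int.card_Icc, hcard, nsmul_eq_mul]
              push_cast
              rfl
          _ ≤ (3 * n) * ((n : ℝ) ^ (-2 * β) * y ^ (1 - β) * K) := by
              gcongr
              linarith
          _ = 3 * K * ((n : ℝ) ^ (1 - 2 * β) * y ^ (1 - β)) := by
              rw [show (1 : ℝ) - 2 * β = 1 + -2 * β by ring, Real.rpow_add (by linarith),
                Real.rpow_one]
              ring
    _ = _ := by rw [← Finset.mul_sum, ← Finset.sum_mul]

theorem sum_Icc_rpow_sub_one_le {p : ℝ} (hp : 0 < p) (hp1 : p ≤ 1) (N : ℕ) :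
    ∑ n ∈ Finset.Icc 1 N, (n : ℝ) ^ (p - 1) ≤ (N : ℝ) ^ p / p := by
  induction N with
  | zero => simp [hp.ne']
  | succ k ih =>
    rw [Finset.sum_Icc_succ_top (by omega)]
    have hk : (0 : ℝ) < ((k + 1 : ℕ) : ℝ) := by positivity
    have h1 : (-1 : ℝ) ≤ -(1 / ((k + 1 : ℕ) : ℝ)) := by
      rw [neg_le_neg_iff, div_le_one hk]
      push_cast
      linarith [k.cast_nonneg (α := ℝ)]
    have h2 := rpow_one_add_le_one_add_mul_self h1 hp.le hp1
    have h3 : (k : ℝ) = ((k + 1 : ℕ) : ℝ) * (1 + -(1 / ((k + 1 : ℕ) : ℝ))) := by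
      field_simp
      push_cast
      ring
    have h4 : (k : ℝ) ^ p ≤ ((k + 1 : ℕ) : ℝ) ^ p - p * ((k + 1 : ℕ) : ℝ) ^ (p - 1) := by
      rw [h3, Real.mul_rpow hk.le (by linarith), Real.rpow_sub_one hk.ne']
      calc _ ≤ ((k + 1 : ℕ) : ℝ) ^ p * (1 + p * -(1 / ((k + 1 : ℕ) : ℝ))) := by gcongr
        _ = _ := by ring
    calc _ ≤ (k : ℝ) ^ p / p + ((k + 1 : ℕ) : ℝ) ^ (p - 1) := by gcongr
      _ ≤ _ := by
        rw [← sub_nonneg]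
        have : 0 ≤ (((k + 1 : ℕ) : ℝ) ^ p - p * ((k + 1 : ℕ) : ℝ) ^ (p - 1) - (k : ℝ) ^ p) / p :=
          div_nonneg (by linarith) hp.le
        convert this using 1
        field_simp
        ring

theorem integral_bI_rpow_le_of_lt_one {α : ℝ} (hα : 0 < α) (hα1 : α < 1) :
    ∃ C : ℝ, ∀ y : ℝ, 0 < y → y < 1 / 2 →
      ∫ x in Set.Icc (-1 : ℝ) 1, bI x y ^ α ≤ C := by
  have hp : 0 < 1 - α := by linarith
  set β := (1 + α) / 2 with hβdef
  have hβ : 1 / 2 < β := by linarith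
  set K := ∫ t : ℝ, (1 + t ^ 2) ^ (-β)
  have hK : 0 ≤ K := integral_nonneg fun t => by positivity
  refine ⟨2 + (2 + 3 * K * (1 / (1 - α))), fun y hy hy1 => ?_⟩
  have hα_int := integrableOn_bI_rpow hα hy hy1
  have hβ_int := integrableOn_bI_rpow (show 0 < β by linarith) hy hy1
  have hsum : (∑ n ∈ Finset.Icc 1 ⌊1 / √y⌋₊, (n : ℝ) ^ (1 - 2 * β)) * y ^ (1 - β) ≤
      1 / (1 - α) := by
    have e : 1 - 2 * β = (1 - α) - 1 := by rw [hβdef]; ring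
    have e2 : y ^ (1 - β) = √y ^ (1 - α) := by
      rw [Real.sqrt_eq_rpow, ← Real.rpow_mul hy.le]
      congr 1
      rw [hβdef]
      ring
    have hfl : (⌊1 / √y⌋₊ : ℝ) ≤ 1 / √y := Nat.floor_le (by positivity)
    have hs : 0 < √y := Real.sqrt_pos.2 hy
    rw [e, e2]
    calc _ ≤ (⌊1 / √y⌋₊ : ℝ) ^ (1 - α) / (1 - α) * √y ^ (1 - α) := by
            gcongr
            exact sum_Icc_rpow_sub_one_le hp (by linarith) _
      _ = ((⌊1 / √y⌋₊ : ℝ) * √y) ^ (1 - α) / (1 - α) := by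
            rw [Real.mul_rpow (by positivity) hs.le]
            ring
      _ ≤ 1 / (1 - α) := by
            gcongr
            exact Real.rpow_le_one (by positivity) ((le_div_iff₀ hs).1 hfl) hp.le
  calc ∫ x in Set.Icc (-1 : ℝ) 1, bI x y ^ α
      ≤ ∫ x in Set.Icc (-1 : ℝ) 1, (1 + bI x y ^ β) := by
        refine integral_mono hα_int ((integrable_const _).add hβ_int) fun x => ?_
        have h0 := bI_nonneg (x := x) hy
        rcases le_or_gt (bI x y) 1 with h | h
        · linarith [Real.rpow_le_one h0 h hα.le, Real.rpow_nonneg h0 β]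
        · linarith [Real.rpow_le_rpow_of_exponent_le h.le (show α ≤ β by linarith)]
    _ = 2 + ∫ x in Set.Icc (-1 : ℝ) 1, bI x y ^ β := by
        rw [integral_add (integrable_const _) hβ_int]
        norm_num
    _ ≤ 2 + (2 + 3 * K * (1 / (1 - α))) := by
        gcongr
        refine (integral_bI_rpow_le hβ hy hy1).trans ?_
        gcongr

theorem integral_bI_le_log :
    ∃ C : ℝ, ∀ y : ℝ, 0 < y → y < 1 / 2 →
      ∫ x in Set.Icc (-1 : ℝ) 1, bI x y ^ (1 : ℝ) ≤ C * Real.log (1 / y) := by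
  set K := ∫ t : ℝ, (1 + t ^ 2) ^ (-(1 : ℝ))
  have hK : 0 ≤ K := integral_nonneg fun t => by positivity
  refine ⟨(2 + 3 * K) / Real.log 2 + 3 * K, fun y hy hy1 => ?_⟩
  have hl2 : 0 < Real.log 2 := Real.log_pos (by norm_num)
  have hlog : Real.log 2 ≤ Real.log (1 / y) :=
    Real.log_le_log (by norm_num) (by rw [le_div_iff₀ hy]; linarith)
  have hs : 0 < √y := Real.sqrt_pos.2 hy
  have hs1 : √y ≤ 1 := Real.sqrt_le_one.2 (by linarith)
  have hfl : (⌊1 / √y⌋₊ : ℝ) ≤ 1 / y := by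
    refine (Nat.floor_le (by positivity)).trans ?_
    gcongr
    nlinarith [Real.mul_self_sqrt hy.le]
  have hfl1 : 1 ≤ ⌊1 / √y⌋₊ := Nat.le_floor (by rw [Nat.cast_one, le_div_iff₀ hs]; linarith)
  have hsum : (∑ n ∈ Finset.Icc 1 ⌊1 / √y⌋₊, (n : ℝ) ^ (1 - 2 * (1 : ℝ))) * y ^ (1 - (1 : ℝ)) ≤
      1 + Real.log (1 / y) := by
    have h := harmonic_le_one_add_log ⌊1 / √y⌋₊
    rw [harmonic_eq_sum_Icc] at h
    push_cast at h
    rw [sub_self, Real.rpow_zero, mul_one, show (1 : ℝ) - 2 * 1 = -1 by norm_num]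
    simp_rw [Real.rpow_neg_one]
    refine h.trans ?_
    gcongr
  calc _ ≤ 2 + 3 * K * (1 + Real.log (1 / y)) := by
        refine (integral_bI_rpow_le (by norm_num) hy hy1).trans ?_
        gcongr
    _ = (2 + 3 * K) / Real.log 2 * Real.log 2 + 3 * K * Real.log (1 / y) := by
        field_simp
        ring
    _ ≤ (2 + 3 * K) / Real.log 2 * Real.log (1 / y) + 3 * K * Real.log (1 / y) := by gcongr
    _ = _ := by ring

theorem integral_bI_rpow_le_of_one_lt {α : ℝ} (hα : 1 < α) :
    ∃ C : ℝ, ∀ y : ℝ, 0 < y → y < 1 / 2 →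
      ∫ x in Set.Icc (-1 : ℝ) 1, bI x y ^ α ≤ C * y ^ (1 - α) := by
  set K := ∫ t : ℝ, (1 + t ^ 2) ^ (-α)
  have hK : 0 ≤ K := integral_nonneg fun t => by positivity
  have hsummable : Summable fun n : ℕ => (n : ℝ) ^ (1 - 2 * α) :=
    Real.summable_nat_rpow.2 (by linarith)
  set S := ∑' n : ℕ, (n : ℝ) ^ (1 - 2 * α)
  refine ⟨2 + 3 * K * S, fun y hy hy1 => ?_⟩
  have h1 : 1 ≤ y ^ (1 - α) :=
    Real.one_le_rpow_of_pos_of_le_one_of_nonpos hy (by linarith) (by linarith)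
  calc _ ≤ 2 + 3 * K * (S * y ^ (1 - α)) := by
        refine (integral_bI_rpow_le (by linarith) hy hy1).trans ?_
        gcongr
        exact hsummable.sum_le_tsum _ fun n _ => by positivity
    _ ≤ 2 * y ^ (1 - α) + 3 * K * (S * y ^ (1 - α)) := by linarith
    _ = _ := by ring

theorem integral_bI_estimate
    (α : ℝ) (hα : 0 < α) :
    ∃ Cα : ℝ, ∀ y : ℝ, 0 < y → y < 1 / 2 →
      IntegrableOn (fun x : ℝ => bI x y ^ α) (Set.Icc (-1 : ℝ) 1) ∧
      (α < 1 → (∫ x in Set.Icc (-1 : ℝ) 1, bI x y ^ α) ≤ Cα) ∧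
      (α = 1 → (∫ x in Set.Icc (-1 : ℝ) 1, bI x y ^ α) ≤ Cα * Real.log (1 / y)) ∧
      (1 < α → (∫ x in Set.Icc (-1 : ℝ) 1, bI x y ^ α) ≤ Cα * y ^ (1 - α)) := by
  rcases lt_trichotomy α 1 with h | rfl | h
  · obtain ⟨C, hC⟩ := integral_bI_rpow_le_of_lt_one hα h
    exact ⟨C, fun y hy hy1 => ⟨integrableOn_bI_rpow hα hy hy1, fun _ => hC y hy hy1,
      fun h' => absurd h' h.ne, fun h' => absurd h' h.not_gt⟩⟩
  · obtain ⟨C, hC⟩ := integral_bI_le_log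
    exact ⟨C, fun y hy hy1 => ⟨integrableOn_bI_rpow hα hy hy1, fun h' => absurd h' (lt_irrefl _),
      fun _ => hC y hy hy1, fun h' => absurd h' (lt_irrefl _)⟩⟩
  · obtain ⟨C, hC⟩ := integral_bI_rpow_le_of_one_lt h
    exact ⟨C, fun y hy hy1 => ⟨integrableOn_bI_rpow hα hy hy1, fun h' => absurd h' h.not_gt,
      fun h' => absurd h' h.ne', fun _ => hC y hy hy1⟩⟩
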